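/- Let k ≥ 0 and let u_0, …, u_k be finite binary sequences such that the 2(k+1) points u_0 1 0^∞, u_0 0 1^∞, …, u_k 1 0^∞, u_k 0 1^∞ of C are pairwise distinct. Then the subgroup {g ∈ Ŝ : g fixes u_i 1 0^∞ and u_i 0 1^∞ for every 0 ≤ i ≤ k} of Ŝ is isomorphic to the direct product of k+1 copies of the Lodha–Moore group _yG_y. -/

import Mathlib

/-- The Cantor set of infinite binary sequences. -/
abbrev Cantor : Type := ℕ → Bool

/-- Concatenation of a finite binary sequence with an infinite binary sequence. -/
def cat (s : List Bool) (η : Cantor) : Cantor :=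
  fun n => if h : n < s.length then s.get ⟨n, h⟩ else η (n - s.length)

/-- `s` is a (finite) prefix of the infinite sequence `ξ`. -/
def IsPrefixOf (s : List Bool) (ξ : Cantor) : Prop := ∃ η : Cantor, ξ = cat s η

/-- The group of self-homeomorphisms of a topological space, with
`(f * g) ξ = f (g ξ)` (i.e. in the right-action convention `ξ·(g h) = (ξ·g)·h`,
the product `g * f` corresponds to the word "apply `f`, then `g`"). -/
instance {α : Type*} [TopologicalSpace α] : Group (α ≃ₜ α) where
  mul f g := g.trans f
  one := Homeomorph.refl α
  inv := Homeomorph.symm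
  mul_assoc _ _ _ := Homeomorph.ext fun _ => rfl
  one_mul _ := Homeomorph.ext fun _ => rfl
  mul_one _ := Homeomorph.ext fun _ => rfl
  inv_mul_cancel f := Homeomorph.ext fun ξ => f.symm_apply_apply ξ

@[simp] lemma homeo_mul_apply {α : Type*} [TopologicalSpace α] (f g : α ≃ₜ α) (ξ : α) :
    (f * g) ξ = f (g ξ) := rfl

@[simp] lemma homeo_one_apply {α : Type*} [TopologicalSpace α] (ξ : α) :
    (1 : α ≃ₜ α) ξ = ξ := rfl

@[simp] lemma homeo_inv_apply {α : Type*} [TopologicalSpace α] (f : α ≃ₜ α) (ξ : α) :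
    (f⁻¹ : α ≃ₜ α) ξ = f.symm ξ := rfl

/-- The data of the basic homeomorphisms `x`, `y`, `x_s`, `y_s`, `p_n` of the Cantor
set, together with their recursive defining equations. -/
structure LMData where
  x : Cantor ≃ₜ Cantor
  y : Cantor ≃ₜ Cantor
  xx : List Bool → Cantor ≃ₜ Cantor
  yy : List Bool → Cantor ≃ₜ Cantor
  p : ℕ → Cantor ≃ₜ Cantor
  hx00 : ∀ η, x (cat [false, false] η) = cat [false] η
  hx01 : ∀ η, x (cat [false, true] η) = cat [true, false] η
  hx1 : ∀ η, x (cat [true] η) = cat [true, true] η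
  hy00 : ∀ η, y (cat [false, false] η) = cat [false] (y η)
  hy01 : ∀ η, y (cat [false, true] η) = cat [true, false] (y.symm η)
  hy1 : ∀ η, y (cat [true] η) = cat [true, true] (y η)
  hxx : ∀ s η, xx s (cat s η) = cat s (x η)
  hxx' : ∀ s ξ, ¬ IsPrefixOf s ξ → xx s ξ = ξ
  hyy : ∀ s η, yy s (cat s η) = cat s (y η)
  hyy' : ∀ s ξ, ¬ IsPrefixOf s ξ → yy s ξ = ξ
  hp1 : ∀ n k η, k < n → p n (cat (List.replicate k true ++ [false]) η) =
      cat (List.replicate (k + 1) true ++ [false]) η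
  hp2 : ∀ n η, p n (cat (List.replicate n true ++ [false]) η) =
      cat (List.replicate (n + 1) true) η
  hp3 : ∀ n η, p n (cat (List.replicate (n + 1) true) η) = cat [false] η

/-- Thompson's group `T`, generated by all `x_s` and all `p_n`. -/
def Tgrp (D : LMData) : Subgroup (Cantor ≃ₜ Cantor) :=
  Subgroup.closure (Set.range D.xx ∪ Set.range D.p)

/-- The group `Ŝ`, generated by all `x_s`, all `y_s` and all `p_n`. -/
def Shat (D : LMData) : Subgroup (Cantor ≃ₜ Cantor) :=
  Subgroup.closure (Set.range D.xx ∪ Set.range D.yy ∪ Set.range D.p)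

/-- The homeomorphism `y₁₀ y₁₁₀⁻¹` (right-action word: first `y₁₀`, then `y₁₁₀⁻¹`). -/
def sgen (D : LMData) : Cantor ≃ₜ Cantor :=
  (D.yy [true, true, false])⁻¹ * D.yy [true, false]

/-- The group `S`, generated by Thompson's group `T` together with `y₁₀ y₁₁₀⁻¹`. -/
def Sgrp (D : LMData) : Subgroup (Cantor ≃ₜ Cantor) :=
  Subgroup.closure (↑(Tgrp D) ∪ {sgen D})

/-- The Lodha–Moore group `_yG_y`, generated by all `x_s` and all `y_s`. -/
def LMgrp (D : LMData) : Subgroup (Cantor ≃ₜ Cantor) :=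
  Subgroup.closure (Set.range D.xx ∪ Set.range D.yy)

/-- The subgroup of self-homeomorphisms of the Cantor set fixing a set `A` pointwise. -/
def fixingSubgroup' (A : Set Cantor) : Subgroup (Cantor ≃ₜ Cantor) where
  carrier := {g | ∀ ξ ∈ A, g ξ = ξ}
  one_mem' := fun ξ _ => rfl
  mul_mem' := by
    intro f g hf hg ξ hξ
    show f (g ξ) = ξ
    rw [hg ξ hξ, hf ξ hξ]
  inv_mem' := by
    intro g hg ξ hξ
    show g.symm ξ = ξ
    refine g.injective ?_
    rw [g.apply_symm_apply, hg ξ hξ]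

namespace LodhaMoore

/-! ### Points of the Cantor set -/

lemma cat_nil (η : Cantor) : cat [] η = η := by
  funext n
  simp [cat]

lemma cat_cons (b : Bool) (s : List Bool) (η : Cantor) :
    cat (b :: s) η = cat [b] (cat s η) := by
  funext n
  rcases n with _ | n <;> simp [cat]

lemma cat_append (s t : List Bool) (η : Cantor) : cat (s ++ t) η = cat s (cat t η) := by
  induction s with
  | nil => simp [cat_nil]
  | cons b s ih => rw [List.cons_append, cat_cons, ih, ← cat_cons]

@[simp] lemma cat_singleton_zero (b : Bool) (η : Cantor) : cat [b] η 0 = b := by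
  simp [cat]

@[simp] lemma cat_singleton_succ (b : Bool) (η : Cantor) (n : ℕ) : cat [b] η (n + 1) = η n := by
  simp [cat]

@[simp] lemma cat_singleton_inj {b c : Bool} {η ζ : Cantor} :
    cat [b] η = cat [c] ζ ↔ b = c ∧ η = ζ := by
  refine ⟨fun h => ⟨by simpa using congrFun h 0, ?_⟩, by rintro ⟨rfl, rfl⟩; rfl⟩
  funext n
  simpa using congrFun h (n + 1)

lemma exists_eq_cat_singleton (ξ : Cantor) : ∃ b η, ξ = cat [b] η := by
  refine ⟨ξ 0, fun n => ξ (n + 1), ?_⟩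
  funext n
  rcases n with _ | n <;> simp

lemma forall_cantor {P : Cantor → Prop} :
    (∀ ξ, P ξ) ↔ (∀ η, P (cat [false] η)) ∧ ∀ η, P (cat [true] η) := by
  refine ⟨fun h => ⟨fun η => h _, fun η => h _⟩, fun h ξ => ?_⟩
  obtain ⟨b, η, rfl⟩ := exists_eq_cat_singleton ξ
  cases b
  exacts [h.1 η, h.2 η]

lemma cat_const (b : Bool) : cat [b] (fun _ => b) = fun _ => b := by
  funext n
  rcases n with _ | n <;> simp

/-! ### Gluing homeomorphisms of the two halves -/

/-- The map acting as `g` on the cone of `0` and as `h` on the cone of `1`. -/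
def joinFun (g h : Cantor → Cantor) (ξ : Cantor) : Cantor :=
  if ξ 0 = true then cat [true] (h fun n => ξ (n + 1)) else cat [false] (g fun n => ξ (n + 1))

lemma joinFun_false (g h : Cantor → Cantor) (η : Cantor) :
    joinFun g h (cat [false] η) = cat [false] (g η) := by
  simp [joinFun]

lemma joinFun_true (g h : Cantor → Cantor) (η : Cantor) :
    joinFun g h (cat [true] η) = cat [true] (h η) := by
  simp [joinFun]

lemma continuous_cat_singleton (b : Bool) : Continuous (cat [b]) := by
  refine continuous_pi fun n => ?_
  rcases n with _ | n
  · simpa using continuous_const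
  · simpa using continuous_apply n

lemma continuous_joinFun {g h : Cantor → Cantor} (hg : Continuous g) (hh : Continuous h) :
    Continuous (joinFun g h) := by
  have htail : Continuous fun (ξ : Cantor) (n : ℕ) => ξ (n + 1) :=
    continuous_pi fun n => continuous_apply (n + 1)
  have hclopen : IsClopen {ξ : Cantor | ξ 0 = true} :=
    (isClopen_discrete ({true} : Set Bool)).preimage (continuous_apply (A := fun _ => Bool) 0)
  refine Continuous.if ?_ ((continuous_cat_singleton _).comp (hh.comp htail))
    ((continuous_cat_singleton _).comp (hg.comp htail))
  simp [hclopen.frontier_eq]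

/-- The homeomorphism acting as `g` on the cone of `0` and as `h` on the cone of `1`. -/
def join (g h : Cantor ≃ₜ Cantor) : Cantor ≃ₜ Cantor where
  toFun := joinFun g h
  invFun := joinFun g.symm h.symm
  left_inv := by
    rw [Function.LeftInverse, forall_cantor]
    simp [joinFun_false, joinFun_true]
  right_inv := by
    rw [Function.RightInverse, Function.LeftInverse, forall_cantor]
    simp [joinFun_false, joinFun_true]
  continuous_toFun := continuous_joinFun g.continuous h.continuous
  continuous_invFun := continuous_joinFun g.symm.continuous h.symm.continuous

@[simp] lemma join_false (g h : Cantor ≃ₜ Cantor) (η : Cantor) :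
    join g h (cat [false] η) = cat [false] (g η) :=
  joinFun_false g h η

@[simp] lemma join_true (g h : Cantor ≃ₜ Cantor) (η : Cantor) :
    join g h (cat [true] η) = cat [true] (h η) :=
  joinFun_true g h η

lemma homeo_ext {g h : Cantor ≃ₜ Cantor} (h0 : ∀ η, g (cat [false] η) = h (cat [false] η))
    (h1 : ∀ η, g (cat [true] η) = h (cat [true] η)) : g = h :=
  Homeomorph.ext (forall_cantor.2 ⟨h0, h1⟩)

lemma join_mul (a b c d : Cantor ≃ₜ Cantor) : join a b * join c d = join (a * c) (b * d) :=
  homeo_ext (by simp) (by simp)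

@[simp] lemma join_one_one : join 1 1 = 1 :=
  homeo_ext (by simp) (by simp)

/-- `join` as a homomorphism from the product of two copies of the homeomorphism group. -/
def joinHom : (Cantor ≃ₜ Cantor) × (Cantor ≃ₜ Cantor) →* (Cantor ≃ₜ Cantor) where
  toFun q := join q.1 q.2
  map_one' := join_one_one
  map_mul' _ _ := (join_mul _ _ _ _).symm

lemma joinHom_apply (q : (Cantor ≃ₜ Cantor) × (Cantor ≃ₜ Cantor)) : joinHom q = join q.1 q.2 :=
  rfl

lemma join_inv (a b : Cantor ≃ₜ Cantor) : (join a b)⁻¹ = join a⁻¹ b⁻¹ :=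
  (map_inv joinHom (a, b)).symm

lemma joinHom_injective : Function.Injective joinHom := by
  rintro ⟨a, b⟩ ⟨c, d⟩ h
  have h' : join a b = join c d := h
  refine Prod.ext (Homeomorph.ext fun η => ?_) (Homeomorph.ext fun η => ?_)
  · simpa using congrArg (fun e : Cantor ≃ₜ Cantor => e (cat [false] η)) h'
  · simpa using congrArg (fun e : Cantor ≃ₜ Cantor => e (cat [true] η)) h'

/-! ### Localizing a homeomorphism to a cone -/

section Localize

variable {z : Cantor ≃ₜ Cantor} {zz : List Bool → Cantor ≃ₜ Cantor}

lemma localized_nil (hz : ∀ s η, zz s (cat s η) = cat s (z η)) : zz [] = z :=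
  Homeomorph.ext fun ξ => by simpa [cat_nil] using hz [] ξ

lemma isPrefixOf_cons {b c : Bool} {s : List Bool} {η : Cantor} :
    IsPrefixOf (b :: s) (cat [c] η) ↔ c = b ∧ IsPrefixOf s η := by
  simp [IsPrefixOf, cat_cons b s]

lemma localized_cons_apply (hz : ∀ s η, zz s (cat s η) = cat s (z η))
    (hz' : ∀ s ξ, ¬ IsPrefixOf s ξ → zz s ξ = ξ) (b : Bool) (s : List Bool) (η : Cantor) :
    zz (b :: s) (cat [b] η) = cat [b] (zz s η) := by
  by_cases h : IsPrefixOf s η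
  · obtain ⟨ζ, rfl⟩ := h
    rw [← cat_cons, hz, hz, cat_cons]
  · rw [hz' s η h, hz']
    simpa [isPrefixOf_cons] using h

lemma localized_false (hz : ∀ s η, zz s (cat s η) = cat s (z η))
    (hz' : ∀ s ξ, ¬ IsPrefixOf s ξ → zz s ξ = ξ) (s : List Bool) :
    zz (false :: s) = join (zz s) 1 :=
  homeo_ext (by simp [localized_cons_apply hz hz']) fun η => by
    rw [hz' _ _ (by simp [isPrefixOf_cons])]
    simp

lemma localized_true (hz : ∀ s η, zz s (cat s η) = cat s (z η))
    (hz' : ∀ s ξ, ¬ IsPrefixOf s ξ → zz s ξ = ξ) (s : List Bool) :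
    zz (true :: s) = join 1 (zz s) :=
  homeo_ext (fun η => by rw [hz' _ _ (by simp [isPrefixOf_cons])]; simp)
    (by simp [localized_cons_apply hz hz'])

end Localize

/-! ### Relations between the generators -/

variable (D : LMData)

lemma x_00 (η : Cantor) : D.x (cat [false] (cat [false] η)) = cat [false] η := by
  rw [← cat_cons, D.hx00]

lemma x_01 (η : Cantor) :
    D.x (cat [false] (cat [true] η)) = cat [true] (cat [false] η) := by
  rw [← cat_cons, D.hx01, cat_cons]

lemma x_1 (η : Cantor) : D.x (cat [true] η) = cat [true] (cat [true] η) := by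
  rw [D.hx1, cat_cons]

lemma y_00 (η : Cantor) : D.y (cat [false] (cat [false] η)) = cat [false] (D.y η) := by
  rw [← cat_cons, D.hy00]

lemma y_01 (η : Cantor) :
    D.y (cat [false] (cat [true] η)) = cat [true] (cat [false] (D.y.symm η)) := by
  rw [← cat_cons, D.hy01, cat_cons]

lemma y_1 (η : Cantor) : D.y (cat [true] η) = cat [true] (cat [true] (D.y η)) := by
  rw [D.hy1, cat_cons]

lemma p_false (η : Cantor) : D.p 0 (cat [false] η) = cat [true] η := by
  simpa using D.hp2 0 η

lemma p_true (η : Cantor) : D.p 0 (cat [true] η) = cat [false] η := by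
  simpa using D.hp3 0 η

lemma x_mul_join (a b c : Cantor ≃ₜ Cantor) :
    D.x * join (join a b) c = join a (join b c) * D.x :=
  homeo_ext (forall_cantor.2 (by simp [x_00, x_01])) (by simp [x_1])

lemma x_mul_x : D.x * D.x = join 1 D.x * D.x * join D.x 1 :=
  homeo_ext (forall_cantor.2 ⟨forall_cantor.2 (by simp [x_00, x_01]),
    by simp [x_01, x_1]⟩) (by simp [x_1])

lemma y_eq : D.y = join D.y (join D.y⁻¹ D.y) * D.x :=
  homeo_ext (forall_cantor.2 (by simp [x_00, x_01, y_00, y_01])) (by simp [x_1, y_1])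

lemma p_mul_join (a b : Cantor ≃ₜ Cantor) : D.p 0 * join a b = join b a * D.p 0 :=
  homeo_ext (by simp [p_false]) (by simp [p_true])

lemma p_mul_p : D.p 0 * D.p 0 = 1 :=
  homeo_ext (by simp [p_false, p_true]) (by simp [p_false, p_true])

lemma x_p_x_p : D.x * D.p 0 * D.x = D.p 0 * D.x⁻¹ * D.p 0 := by
  rw [mul_assoc (D.p 0), ← inv_mul_eq_iff_eq_mul, inv_eq_of_mul_eq_one_left (p_mul_p D),
    eq_inv_mul_iff_mul_eq]
  exact homeo_ext (forall_cantor.2 (by simp [x_00, x_01, x_1, p_false, p_true]))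
    (by simp [x_00, x_01, x_1, p_true])

/-! ### Transporting cosets -/

section Transport

variable {Γ ι : Type*} [Group Γ] (K : Subgroup Γ) (c : ι → Γ)

/-- `g` carries the coset represented by `c i` to the one represented by `c j`. -/
def Transports (g : Γ) (i j : ι) : Prop := ∃ k ∈ K, c j * g = k * c i

variable {K c}

lemma Transports.mul {g h : Γ} {i j l : ι} (hg : Transports K c g j l)
    (hh : Transports K c h i j) : Transports K c (g * h) i l := by
  obtain ⟨a, ha, hag⟩ := hg
  obtain ⟨b, hb, hbh⟩ := hh
  exact ⟨a * b, K.mul_mem ha hb, by rw [← mul_assoc, hag, mul_assoc, hbh, mul_assoc]⟩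

lemma Transports.inv {g : Γ} {i j : ι} (hg : Transports K c g i j) :
    Transports K c g⁻¹ j i := by
  obtain ⟨a, ha, hag⟩ := hg
  refine ⟨a⁻¹, K.inv_mem ha, ?_⟩
  rw [mul_inv_eq_iff_eq_mul, mul_assoc, hag, inv_mul_cancel_left]

lemma Transports.one (i : ι) : Transports K c 1 i i :=
  ⟨1, K.one_mem, by simp⟩

variable (K c)

/-- The subgroup of the elements that permute the cosets represented by `c`. -/
def transporter : Subgroup Γ where
  carrier := {g | (∀ i, ∃ j, Transports K c g i j) ∧ ∀ j, ∃ i, Transports K c g i j}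
  one_mem' := ⟨fun i => ⟨i, .one i⟩, fun i => ⟨i, .one i⟩⟩
  mul_mem' := by
    rintro g h ⟨hg, hg'⟩ ⟨hh, hh'⟩
    refine ⟨fun i => ?_, fun l => ?_⟩
    · obtain ⟨j, hj⟩ := hh i
      obtain ⟨l, hl⟩ := hg j
      exact ⟨l, hl.mul hj⟩
    · obtain ⟨j, hj⟩ := hg' l
      obtain ⟨i, hi⟩ := hh' j
      exact ⟨i, hj.mul hi⟩
  inv_mem' := by
    rintro g ⟨hg, hg'⟩
    exact ⟨fun i => (hg' i).imp fun _ h => h.inv, fun i => (hg i).imp fun _ h => h.inv⟩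

variable {K c}

lemma mem_transporter {g : Γ} : g ∈ transporter K c ↔
    (∀ i, ∃ j, Transports K c g i j) ∧ ∀ j, ∃ i, Transports K c g i j :=
  Iff.rfl

end Transport

/-! ### The Lodha–Moore group and its elements respecting the two halves -/

lemma xx_nil : D.xx [] = D.x := localized_nil D.hxx

lemma yy_nil : D.yy [] = D.y := localized_nil D.hyy

lemma xx_mem (s : List Bool) : D.xx s ∈ LMgrp D :=
  Subgroup.subset_closure (Or.inl ⟨s, rfl⟩)

lemma yy_mem (s : List Bool) : D.yy s ∈ LMgrp D :=
  Subgroup.subset_closure (Or.inr ⟨s, rfl⟩)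

lemma x_mem : D.x ∈ LMgrp D := xx_nil D ▸ xx_mem D []

lemma y_mem : D.y ∈ LMgrp D := yy_nil D ▸ yy_mem D []

variable {D}

lemma join_left_mem {g : Cantor ≃ₜ Cantor} (hg : g ∈ LMgrp D) : join g 1 ∈ LMgrp D := by
  suffices h : LMgrp D ≤ (LMgrp D).comap (joinHom.comp (MonoidHom.inl _ _)) from h hg
  rw [LMgrp, Subgroup.closure_le]
  rintro _ (⟨s, rfl⟩ | ⟨s, rfl⟩)
  · have h := xx_mem D (false :: s)
    rw [localized_false D.hxx D.hxx'] at h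
    exact h
  · have h := yy_mem D (false :: s)
    rw [localized_false D.hyy D.hyy'] at h
    exact h

lemma join_right_mem {g : Cantor ≃ₜ Cantor} (hg : g ∈ LMgrp D) : join 1 g ∈ LMgrp D := by
  suffices h : LMgrp D ≤ (LMgrp D).comap (joinHom.comp (MonoidHom.inr _ _)) from h hg
  rw [LMgrp, Subgroup.closure_le]
  rintro _ (⟨s, rfl⟩ | ⟨s, rfl⟩)
  · have h := xx_mem D (true :: s)
    rw [localized_true D.hxx D.hxx'] at h
    exact h
  · have h := yy_mem D (true :: s)
    rw [localized_true D.hyy D.hyy'] at h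
    exact h

lemma join_mem {g h : Cantor ≃ₜ Cantor} (hg : g ∈ LMgrp D) (hh : h ∈ LMgrp D) :
    join g h ∈ LMgrp D := by
  simpa [join_mul] using mul_mem (join_left_mem hg) (join_right_mem hh)

variable (D) in
/-- The elements of the Lodha–Moore group that act separately on the two halves. -/
def splitGrp : Subgroup (Cantor ≃ₜ Cantor) :=
  ((LMgrp D).prod (LMgrp D)).map joinHom

lemma mem_splitGrp {g : Cantor ≃ₜ Cantor} :
    g ∈ splitGrp D ↔ ∃ a ∈ LMgrp D, ∃ b ∈ LMgrp D, g = join a b := by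
  simp only [splitGrp, Subgroup.mem_map, Subgroup.mem_prod, Prod.exists, joinHom_apply]
  constructor
  · rintro ⟨a, b, ⟨ha, hb⟩, rfl⟩
    exact ⟨a, ha, b, hb, rfl⟩
  · rintro ⟨a, ha, b, hb, rfl⟩
    exact ⟨a, b, ⟨ha, hb⟩, rfl⟩

lemma join_mem_splitGrp {g h : Cantor ≃ₜ Cantor} (hg : g ∈ LMgrp D) (hh : h ∈ LMgrp D) :
    join g h ∈ splitGrp D :=
  mem_splitGrp.2 ⟨g, hg, h, hh, rfl⟩

variable (D) in
/-- An element of the Lodha–Moore group carrying `w 1 0^∞` to `1 0^∞` and `w 0 1^∞` to `0 1^∞`. -/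
def center : List Bool → Cantor ≃ₜ Cantor
  | [] => 1
  | false :: w => D.x * join (center w) 1
  | true :: w => D.x⁻¹ * join 1 (center w)

lemma center_mem : ∀ w, center D w ∈ LMgrp D
  | [] => one_mem _
  | false :: w => mul_mem (x_mem D) (join_left_mem (center_mem w))
  | true :: w => mul_mem (inv_mem (x_mem D)) (join_right_mem (center_mem w))

lemma transports_nil {g h : Cantor ≃ₜ Cantor} (hg : g ∈ LMgrp D) (hh : h ∈ LMgrp D) :
    Transports (splitGrp D) (center D) (join g h) [] [] :=
  ⟨join g h, join_mem_splitGrp hg hh, by simp [center]⟩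

lemma Transports.join_left {g h : Cantor ≃ₜ Cantor} {v w : List Bool}
    (hg : Transports (splitGrp D) (center D) g v w) (hh : h ∈ LMgrp D) :
    Transports (splitGrp D) (center D) (join g h) (false :: v) (false :: w) := by
  obtain ⟨k, hk, hkg⟩ := hg
  obtain ⟨a, ha, b, hb, rfl⟩ := mem_splitGrp.1 hk
  refine ⟨join a (join b h), join_mem_splitGrp ha (join_mem hb hh), ?_⟩
  rw [center, center, mul_assoc, join_mul, hkg, ← mul_assoc, ← x_mul_join, mul_assoc, join_mul]
  simp

lemma Transports.join_right {g h : Cantor ≃ₜ Cantor} {v w : List Bool} (hg : g ∈ LMgrp D)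
    (hh : Transports (splitGrp D) (center D) h v w) :
    Transports (splitGrp D) (center D) (join g h) (true :: v) (true :: w) := by
  obtain ⟨k, hk, hkg⟩ := hh
  obtain ⟨a, ha, b, hb, rfl⟩ := mem_splitGrp.1 hk
  refine ⟨join (join g a) b, join_mem_splitGrp (join_mem hg ha) hb, ?_⟩
  have h : D.x⁻¹ * join g (join a b) = join (join g a) b * D.x⁻¹ := by
    rw [inv_mul_eq_iff_eq_mul, ← mul_assoc, x_mul_join, mul_inv_cancel_right]
  rw [center, center, mul_assoc, join_mul, hkg, ← mul_assoc, ← h, mul_assoc, join_mul]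
  simp

lemma transports_x_nil : Transports (splitGrp D) (center D) D.x [] [true] :=
  ⟨1, one_mem _, by simp [center]⟩

lemma transports_x_0 : Transports (splitGrp D) (center D) D.x [false] [] :=
  ⟨1, one_mem _, by simp [center]⟩

lemma transports_x_00 (q : List Bool) :
    Transports (splitGrp D) (center D) D.x (false :: false :: q) (false :: q) := by
  refine ⟨join 1 D.x, join_mem_splitGrp (one_mem _) (x_mem D), ?_⟩
  have h : join (D.x * join (center D q) 1) 1 = join D.x 1 * join (join (center D q) 1) 1 := by
    simp [join_mul]
  have h' : join (center D q) 1 * D.x = D.x * join (join (center D q) 1) 1 := by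
    simp [x_mul_join]
  rw [center, center, center, h, mul_assoc, h', ← mul_assoc, ← mul_assoc, ← mul_assoc, ← x_mul_x]

lemma transports_x_01 (q : List Bool) :
    Transports (splitGrp D) (center D) D.x (false :: true :: q) (true :: false :: q) := by
  refine ⟨1, one_mem _, ?_⟩
  have h : join 1 (D.x * join (center D q) 1) = join 1 D.x * join 1 (join (center D q) 1) := by
    simp [join_mul]
  have h' : join (D.x⁻¹ * join 1 (center D q)) 1
      = (join D.x 1)⁻¹ * join (join 1 (center D q)) 1 := by
    simp [join_mul, join_inv]
  rw [center, center, center, center, h, h', one_mul, mul_assoc, mul_assoc, ← x_mul_join,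
    inv_mul_eq_iff_eq_mul]
  simp only [← mul_assoc]
  rw [mul_left_inj, eq_mul_inv_iff_mul_eq, x_mul_x]

lemma transports_x_1 (q : List Bool) :
    Transports (splitGrp D) (center D) D.x (true :: q) (true :: true :: q) := by
  refine ⟨join D.x 1, join_mem_splitGrp (x_mem D) (one_mem _), ?_⟩
  have h : join 1 (D.x⁻¹ * join 1 (center D q))
      = (join 1 D.x)⁻¹ * join 1 (join 1 (center D q)) := by
    simp [join_mul, join_inv]
  have h' : join 1 (join 1 (center D q)) * D.x = D.x * join 1 (center D q) := by
    simp [← x_mul_join]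
  rw [center, center, h, mul_assoc, mul_assoc, h']
  simp only [← mul_assoc]
  rw [mul_left_inj, eq_mul_inv_iff_mul_eq, mul_assoc, x_mul_x]
  group

lemma x_mem_transporter : D.x ∈ transporter (splitGrp D) (center D) := by
  refine mem_transporter.2 ⟨fun w => ?_, fun w => ?_⟩
  · match w with
    | [] => exact ⟨_, transports_x_nil⟩
    | [false] => exact ⟨_, transports_x_0⟩
    | false :: false :: q => exact ⟨_, transports_x_00 q⟩
    | false :: true :: q => exact ⟨_, transports_x_01 q⟩
    | true :: q => exact ⟨_, transports_x_1 q⟩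
  · match w with
    | [true] => exact ⟨_, transports_x_nil⟩
    | [] => exact ⟨_, transports_x_0⟩
    | false :: q => exact ⟨_, transports_x_00 q⟩
    | true :: false :: q => exact ⟨_, transports_x_01 q⟩
    | true :: true :: q => exact ⟨_, transports_x_1 q⟩

lemma join_mem_transporter {g h : Cantor ≃ₜ Cantor} (hg : g ∈ LMgrp D) (hh : h ∈ LMgrp D)
    (hg' : g ∈ transporter (splitGrp D) (center D))
    (hh' : h ∈ transporter (splitGrp D) (center D)) :
    join g h ∈ transporter (splitGrp D) (center D) := by
  refine mem_transporter.2 ⟨fun w => ?_, fun w => ?_⟩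
  · match w with
    | [] => exact ⟨_, transports_nil hg hh⟩
    | false :: q =>
      obtain ⟨r, hr⟩ := hg'.1 q
      exact ⟨_, hr.join_left hh⟩
    | true :: q =>
      obtain ⟨r, hr⟩ := hh'.1 q
      exact ⟨_, hr.join_right hg⟩
  · match w with
    | [] => exact ⟨_, transports_nil hg hh⟩
    | false :: q =>
      obtain ⟨r, hr⟩ := hg'.2 q
      exact ⟨_, hr.join_left hh⟩
    | true :: q =>
      obtain ⟨r, hr⟩ := hh'.2 q
      exact ⟨_, hr.join_right hg⟩

lemma transports_y (w : List Bool) :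
    (∃ v, Transports (splitGrp D) (center D) D.y w v) ∧
      ∃ v, Transports (splitGrp D) (center D) D.y v w := by
  have hy := y_mem D
  have hy' : D.y⁻¹ ∈ LMgrp D := inv_mem hy
  have hd : join D.y⁻¹ D.y ∈ LMgrp D := join_mem hy' hy
  have hnil := transports_nil hy hd
  have htrue := (transports_nil hy' hy).join_right hy
  have ofX {a b c : List Bool} (hx : Transports (splitGrp D) (center D) D.x a b)
      (hd : Transports (splitGrp D) (center D) (join D.y (join D.y⁻¹ D.y)) b c) :
      Transports (splitGrp D) (center D) D.y a c := by
    rw [y_eq]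
    exact hd.mul hx
  have toX {b c : List Bool}
      (hd : Transports (splitGrp D) (center D) (join D.y (join D.y⁻¹ D.y)) b c) :
      ∃ a, Transports (splitGrp D) (center D) D.y a c :=
    (x_mem_transporter.2 b).imp fun _ hx => ofX hx hd
  induction hn : w.length using Nat.strong_induction_on generalizing w with
  | _ n ih =>
    subst hn
    replace ih (q : List Bool) (hq : q.length < w.length) := ih q.length hq q rfl
    constructor
    · match w with
      | [] => exact ⟨_, ofX transports_x_nil htrue⟩
      | [false] => exact ⟨_, ofX transports_x_0 hnil⟩
      | false :: false :: q =>
        obtain ⟨r, hr⟩ := (ih q (by simp)).1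
        exact ⟨_, ofX (transports_x_00 q) (hr.join_left hd)⟩
      | false :: true :: q =>
        obtain ⟨r, hr⟩ := (ih q (by simp)).2
        exact ⟨_, ofX (transports_x_01 q) ((hr.inv.join_left hy).join_right hy)⟩
      | true :: q =>
        obtain ⟨r, hr⟩ := (ih q (by simp)).1
        exact ⟨_, ofX (transports_x_1 q) ((hr.join_right hy').join_right hy)⟩
    · match w with
      | [] => exact toX hnil
      | [true] => exact toX htrue
      | false :: q =>
        obtain ⟨r, hr⟩ := (ih q (by simp)).2
        exact toX (hr.join_left hd)
      | true :: false :: q =>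
        obtain ⟨r, hr⟩ := (ih q (by simp)).1
        exact toX ((hr.inv.join_left hy).join_right hy)
      | true :: true :: q =>
        obtain ⟨r, hr⟩ := (ih q (by simp)).2
        exact toX ((hr.join_right hy').join_right hy)

lemma y_mem_transporter : D.y ∈ transporter (splitGrp D) (center D) :=
  mem_transporter.2 ⟨fun w => (transports_y w).1, fun w => (transports_y w).2⟩

lemma LMgrp_le_transporter : LMgrp D ≤ transporter (splitGrp D) (center D) := by
  rw [LMgrp, Subgroup.closure_le]
  rintro _ (⟨s, rfl⟩ | ⟨s, rfl⟩) <;> rw [SetLike.mem_coe]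
  · induction s with
    | nil => exact xx_nil D ▸ x_mem_transporter
    | cons b s ih =>
      cases b
      · rw [localized_false D.hxx D.hxx']
        exact join_mem_transporter (xx_mem D s) (one_mem _) ih (one_mem _)
      · rw [localized_true D.hxx D.hxx']
        exact join_mem_transporter (one_mem _) (xx_mem D s) (one_mem _) ih
  · induction s with
    | nil => exact yy_nil D ▸ y_mem_transporter
    | cons b s ih =>
      cases b
      · rw [localized_false D.hyy D.hyy']
        exact join_mem_transporter (yy_mem D s) (one_mem _) ih (one_mem _)
      · rw [localized_true D.hyy D.hyy']
        exact join_mem_transporter (one_mem _) (yy_mem D s) (one_mem _) ih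

/-! ### The full group -/

lemma LMgrp_le_Shat : LMgrp D ≤ Shat D :=
  Subgroup.closure_mono Set.subset_union_left

lemma p_mem (n : ℕ) : D.p n ∈ Shat D :=
  Subgroup.subset_closure (Or.inr ⟨n, rfl⟩)

lemma eq_cat_replicate (n : ℕ) (ξ : Cantor) :
    (∃ k < n, ∃ η, ξ = cat (List.replicate k true ++ [false]) η) ∨
      ∃ η, ξ = cat (List.replicate n true) η := by
  induction n with
  | zero => exact Or.inr ⟨ξ, (cat_nil ξ).symm⟩
  | succ n ih =>
    obtain ⟨k, hk, h⟩ | ⟨η, rfl⟩ := ih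
    · exact Or.inl ⟨k, by omega, h⟩
    · obtain ⟨b, ζ, rfl⟩ := exists_eq_cat_singleton η
      rw [← cat_append]
      cases b
      · exact Or.inl ⟨n, by omega, ζ, rfl⟩
      · exact Or.inr ⟨ζ, by rw [List.replicate_succ']⟩

lemma not_isPrefixOf_replicate {k n : ℕ} (h : k < n) (η : Cantor) :
    ¬ IsPrefixOf (List.replicate n true) (cat (List.replicate k true ++ [false]) η) := by
  induction k generalizing n with
  | zero =>
    obtain ⟨n, rfl⟩ := Nat.exists_eq_add_one.2 h
    simp [List.replicate_succ, isPrefixOf_cons]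
  | succ k ih =>
    obtain ⟨n, rfl⟩ := Nat.exists_eq_add_one.2 (Nat.zero_lt_of_lt h)
    rw [List.replicate_succ, List.replicate_succ, List.cons_append, cat_cons, isPrefixOf_cons]
    exact fun h' => ih (by omega) h'.2

lemma p_succ_mul (n : ℕ) : D.p (n + 1) * D.xx (List.replicate n true) = D.p n := by
  refine Homeomorph.ext fun ξ => ?_
  rw [homeo_mul_apply]
  obtain ⟨k, hk, η, rfl⟩ | ⟨η, rfl⟩ := eq_cat_replicate n ξ
  · rw [D.hxx' _ _ (not_isPrefixOf_replicate hk η), D.hp1 _ _ _ hk, D.hp1 _ _ _ (by omega)]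
  · rw [D.hxx]
    obtain ⟨b, ζ, rfl⟩ := exists_eq_cat_singleton η
    cases b
    · rw [← cat_append, D.hp2]
      obtain ⟨b, θ, rfl⟩ := exists_eq_cat_singleton ζ
      cases b
      · rw [x_00, ← cat_append, D.hp1 _ _ _ (by omega), cat_append]
      · rw [x_01, ← cat_append, ← List.replicate_succ', ← cat_append, D.hp2,
          List.replicate_succ', cat_append]
    · rw [x_1, ← cat_append, ← List.replicate_succ', ← cat_append, ← List.replicate_succ',
        ← cat_append, ← List.replicate_succ', D.hp3, D.hp3]

lemma Shat_le {H : Subgroup (Cantor ≃ₜ Cantor)} (hG : LMgrp D ≤ H) (hp : D.p 0 ∈ H) :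
    Shat D ≤ H := by
  rw [Shat, Subgroup.closure_le]
  rintro _ (h | ⟨n, rfl⟩)
  · exact hG (Subgroup.subset_closure h)
  · rw [SetLike.mem_coe]
    induction n with
    | zero => exact hp
    | succ n ih =>
      rw [eq_mul_inv_of_mul_eq (p_succ_mul (D := D) n)]
      exact mul_mem ih (inv_mem (hG (xx_mem D _)))

variable (D) in
/-- An element of `Ŝ` carrying the gap indexed by `d` to the gap between `1^∞` and `0^∞`. -/
def recenter : Option (List Bool) → Cantor ≃ₜ Cantor
  | none => 1
  | some w => D.p 0 * center D w

lemma recenter_mem : ∀ d, recenter D d ∈ Shat D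
  | none => one_mem _
  | some w => mul_mem (p_mem 0) (LMgrp_le_Shat (center_mem w))

lemma Transports.recenter {g : Cantor ≃ₜ Cantor} {v w : List Bool}
    (h : Transports (splitGrp D) (center D) g v w) :
    Transports (LMgrp D) (recenter D) g (some v) (some w) := by
  obtain ⟨k, hk, hkg⟩ := h
  obtain ⟨a, ha, b, hb, rfl⟩ := mem_splitGrp.1 hk
  refine ⟨join b a, join_mem hb ha, ?_⟩
  rw [LodhaMoore.recenter, LodhaMoore.recenter, mul_assoc, hkg, ← mul_assoc, p_mul_join, mul_assoc]

lemma transports_none {g : Cantor ≃ₜ Cantor} (hg : g ∈ LMgrp D) :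
    Transports (LMgrp D) (recenter D) g none none :=
  ⟨g, hg, by simp [recenter]⟩

lemma transports_p_nil : Transports (LMgrp D) (recenter D) (D.p 0) none (some []) :=
  ⟨1, one_mem _, by simp [recenter, center, p_mul_p]⟩

lemma transports_p_false (q : List Bool) :
    Transports (LMgrp D) (recenter D) (D.p 0) (some (false :: q)) (some (true :: q)) := by
  refine ⟨D.x, x_mem D, ?_⟩
  rw [recenter, recenter, center, center, mul_assoc, mul_assoc, ← p_mul_join]
  simp only [← mul_assoc]
  rw [x_p_x_p]

lemma p_inv : (D.p 0)⁻¹ = D.p 0 := inv_eq_of_mul_eq_one_left (p_mul_p D)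

lemma exists_transports_p (d : Option (List Bool)) :
    ∃ e, Transports (LMgrp D) (recenter D) (D.p 0) d e := by
  match d with
  | none => exact ⟨_, transports_p_nil⟩
  | some [] => exact ⟨_, p_inv (D := D) ▸ transports_p_nil.inv⟩
  | some (false :: q) => exact ⟨_, transports_p_false q⟩
  | some (true :: q) => exact ⟨_, p_inv (D := D) ▸ (transports_p_false q).inv⟩

lemma Shat_le_transporter : Shat D ≤ transporter (LMgrp D) (recenter D) := by
  refine Shat_le (fun g hg => mem_transporter.2 ⟨fun d => ?_, fun d => ?_⟩)
    (mem_transporter.2 ⟨exists_transports_p, fun d => ?_⟩)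
  · match d with
    | none => exact ⟨_, transports_none hg⟩
    | some w =>
      obtain ⟨v, hv⟩ := (LMgrp_le_transporter hg).1 w
      exact ⟨_, hv.recenter⟩
  · match d with
    | none => exact ⟨_, transports_none hg⟩
    | some w =>
      obtain ⟨v, hv⟩ := (LMgrp_le_transporter hg).2 w
      exact ⟨_, hv.recenter⟩
  · obtain ⟨e, he⟩ := exists_transports_p (D := D) d
    exact ⟨e, p_inv (D := D) ▸ he.inv⟩

/-! ### Gaps -/

/-- The right end of a gap: `w 1 0^∞` for the gap indexed by the word `w`, and `0^∞` for the gap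
between `1^∞` and `0^∞`. -/
def gapRight : Option (List Bool) → Cantor
  | none => fun _ => false
  | some w => cat (w ++ [true]) fun _ => false

/-- The left end of a gap: `w 0 1^∞` for the gap indexed by the word `w`, and `1^∞` for the gap
between `1^∞` and `0^∞`. -/
def gapLeft : Option (List Bool) → Cantor
  | none => fun _ => true
  | some w => cat (w ++ [false]) fun _ => true

lemma gapRight_nil : gapRight (some []) = cat [true] fun _ => false := rfl

lemma gapLeft_nil : gapLeft (some []) = cat [false] fun _ => true := rfl

lemma gapRight_cons (b : Bool) (w : List Bool) :
    gapRight (some (b :: w)) = cat [b] (gapRight (some w)) :=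
  cat_cons b (w ++ [true]) fun _ => false

lemma gapLeft_cons (b : Bool) (w : List Bool) :
    gapLeft (some (b :: w)) = cat [b] (gapLeft (some w)) :=
  cat_cons b (w ++ [false]) fun _ => true

lemma gapRight_some_ne (w : List Bool) : gapRight (some w) ≠ fun _ => false := by
  induction w with
  | nil => rw [gapRight_nil, ← cat_const false]; simp
  | cons b w ih => rw [gapRight_cons, ← cat_const false]; simp [ih]

lemma gapRight_injective : Function.Injective gapRight := by
  have hsome (v w : List Bool) (h : gapRight (some v) = gapRight (some w)) : v = w := by
    induction v generalizing w with
    | nil =>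
      cases w with
      | nil => rfl
      | cons b w =>
        rw [gapRight_nil, gapRight_cons, cat_singleton_inj] at h
        exact absurd h.2.symm (gapRight_some_ne w)
    | cons c v ih =>
      cases w with
      | nil =>
        rw [gapRight_nil, gapRight_cons, cat_singleton_inj] at h
        exact absurd h.2 (gapRight_some_ne v)
      | cons b w =>
        rw [gapRight_cons, gapRight_cons, cat_singleton_inj] at h
        rw [h.1, ih w h.2]
  rintro (_ | v) (_ | w) h
  · rfl
  · exact absurd h.symm (gapRight_some_ne w)
  · exact absurd h (gapRight_some_ne v)
  · rw [hsome v w h]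

lemma eq_const_of_eq_cat {b : Bool} {ξ : Cantor} (h : ξ = cat [b] (cat [b] ξ)) :
    ξ = fun _ => b := by
  funext n
  induction n using Nat.twoStepInduction with
  | zero => rw [h]; simp
  | one => rw [h]; simp
  | more n ih _ => rw [h]; simpa using ih

lemma x_const (b : Bool) : D.x (fun _ => b) = fun _ => b := by
  cases b
  · simpa only [cat_const] using x_00 D fun _ => false
  · simpa only [cat_const] using x_1 D fun _ => true

lemma y_const (b : Bool) : D.y (fun _ => b) = fun _ => b := by
  apply eq_const_of_eq_cat
  cases b
  · have h := y_00 D fun _ => false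
    simp only [cat_const] at h
    rw [← h, ← h]
  · simpa only [cat_const] using y_1 D fun _ => true

lemma join_const {g h : Cantor ≃ₜ Cantor} {b : Bool} (hg : g (fun _ => b) = fun _ => b)
    (hh : h (fun _ => b) = fun _ => b) : join g h (fun _ => b) = fun _ => b := by
  cases b
  · rw [← cat_const, join_false, hg]
  · rw [← cat_const, join_true, hh]

lemma apply_const {g : Cantor ≃ₜ Cantor} (hg : g ∈ LMgrp D) (b : Bool) :
    g (fun _ => b) = fun _ => b := by
  suffices h : LMgrp D ≤ fixingSubgroup' {fun _ => b} from h hg _ rfl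
  rw [LMgrp, Subgroup.closure_le]
  rintro _ (⟨s, rfl⟩ | ⟨s, rfl⟩) _ rfl
  · induction s with
    | nil => rw [xx_nil, x_const]
    | cons c s ih =>
      cases c
      · rw [localized_false D.hxx D.hxx', join_const ih rfl]
      · rw [localized_true D.hxx D.hxx', join_const rfl ih]
  · induction s with
    | nil => rw [yy_nil, y_const]
    | cons c s ih =>
      cases c
      · rw [localized_false D.hyy D.hyy', join_const ih rfl]
      · rw [localized_true D.hyy D.hyy', join_const rfl ih]

lemma center_gap (w : List Bool) :
    center D w (gapRight (some w)) = gapRight (some []) ∧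
      center D w (gapLeft (some w)) = gapLeft (some []) := by
  have h00 := x_00 D fun _ => true
  have h01 := x_01 D fun _ => false
  have h01' := x_01 D fun _ => true
  have h1 := x_1 D fun _ => false
  rw [cat_const] at h01 h01'
  induction w with
  | nil => exact ⟨rfl, rfl⟩
  | cons b w ih =>
    rw [gapRight_nil, gapLeft_nil] at ih ⊢
    cases b
    · simp [center, gapRight_cons, gapLeft_cons, ih, h00, h01]
    · simp [center, gapRight_cons, gapLeft_cons, ih, ← h01', ← h1]

lemma recenter_gap (d : Option (List Bool)) :
    recenter D d (gapRight d) = (fun _ => false) ∧ recenter D d (gapLeft d) = fun _ => true := by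
  cases d with
  | none => exact ⟨rfl, rfl⟩
  | some w => simp [recenter, center_gap, gapRight_nil, gapLeft_nil, p_true, p_false, cat_const]

lemma Transports.gap {g : Cantor ≃ₜ Cantor} {d e : Option (List Bool)}
    (h : Transports (LMgrp D) (LodhaMoore.recenter D) g d e) :
    g (gapRight d) = gapRight e ∧ g (gapLeft d) = gapLeft e := by
  obtain ⟨k, hk, hkg⟩ := h
  have key (ξ : Cantor) : LodhaMoore.recenter D e (g ξ) = k (LodhaMoore.recenter D d ξ) :=
    congrArg (fun f : Cantor ≃ₜ Cantor => f ξ) hkg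
  constructor <;> apply (LodhaMoore.recenter D e).injective
  · rw [key, (recenter_gap d).1, (recenter_gap e).1, apply_const hk]
  · rw [key, (recenter_gap d).2, (recenter_gap e).2, apply_const hk]

lemma mem_LMgrp_of_fixes {g : Cantor ≃ₜ Cantor} (hg : g ∈ Shat D)
    (h : g (gapRight none) = gapRight none) : g ∈ LMgrp D := by
  obtain ⟨e, he⟩ := (Shat_le_transporter hg).1 none
  obtain rfl : none = e := gapRight_injective (h.symm.trans he.gap.1)
  obtain ⟨k, hk, hkg⟩ := he
  simp only [recenter, one_mul, mul_one] at hkg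
  exact hkg ▸ hk

lemma mem_splitGrp_of_fixes {g : Cantor ≃ₜ Cantor} (hg : g ∈ LMgrp D)
    (h : g (gapRight (some [])) = gapRight (some [])) : g ∈ splitGrp D := by
  obtain ⟨v, hv⟩ := (LMgrp_le_transporter hg).1 []
  obtain rfl : [] = v :=
    Option.some_injective _ (gapRight_injective (h.symm.trans hv.recenter.gap.1))
  obtain ⟨k, hk, hkg⟩ := hv
  simp only [center, one_mul, mul_one] at hkg
  exact hkg ▸ hk

/-! ### Stabilizers of finite sets of gaps -/

variable (D) in
/-- The subgroup of `Ŝ` fixing the ends of all the gaps indexed by `s`. -/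
def gapStab (s : Finset (Option (List Bool))) : Subgroup (Cantor ≃ₜ Cantor) :=
  Shat D ⊓ fixingSubgroup' {ξ | ∃ d ∈ s, ξ = gapRight d ∨ ξ = gapLeft d}

lemma mem_gapStab {s : Finset (Option (List Bool))} {g : Cantor ≃ₜ Cantor} :
    g ∈ gapStab D s ↔
      g ∈ Shat D ∧ ∀ d ∈ s, g (gapRight d) = gapRight d ∧ g (gapLeft d) = gapLeft d := by
  refine and_congr_right fun _ => ⟨fun h d hd => ⟨h _ ⟨d, hd, Or.inl rfl⟩, h _ ⟨d, hd, Or.inr rfl⟩⟩,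
    ?_⟩
  rintro h _ ⟨d, hd, rfl | rfl⟩
  exacts [(h d hd).1, (h d hd).2]

lemma gapStab_le_LMgrp {s : Finset (Option (List Bool))} (hs : none ∈ s) :
    gapStab D s ≤ LMgrp D := fun _ hg =>
  mem_LMgrp_of_fixes (mem_gapStab.1 hg).1 ((mem_gapStab.1 hg).2 none hs).1

lemma gapStab_singleton_none : gapStab D {none} = LMgrp D := by
  refine le_antisymm (gapStab_le_LMgrp (by simp)) fun g hg => mem_gapStab.2 ⟨LMgrp_le_Shat hg, ?_⟩
  simpa using ⟨apply_const hg false, apply_const hg true⟩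

lemma map_conj_gapStab {c : Cantor ≃ₜ Cantor} (hc : c ∈ Shat D)
    {σ : Option (List Bool) → Option (List Bool)}
    (hσ : ∀ d, c (gapRight d) = gapRight (σ d) ∧ c (gapLeft d) = gapLeft (σ d))
    (s : Finset (Option (List Bool))) :
    (gapStab D s).map (MulAut.conj c).toMonoidHom = gapStab D (s.image σ) := by
  ext g
  rw [Subgroup.mem_map_equiv, MulAut.conj_symm_apply, mem_gapStab, mem_gapStab,
    Subgroup.mul_mem_cancel_right _ hc, Subgroup.mul_mem_cancel_left _ (inv_mem hc)]
  simp [Homeomorph.symm_apply_eq, hσ]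

/-- Every element of `Ŝ` permutes the gaps. -/
lemma exists_gap_map {c : Cantor ≃ₜ Cantor} (hc : c ∈ Shat D) :
    ∃ σ : Option (List Bool) → Option (List Bool), Function.Injective σ ∧
      ∀ d, c (gapRight d) = gapRight (σ d) ∧ c (gapLeft d) = gapLeft (σ d) := by
  choose σ hσ using (Shat_le_transporter hc).1
  refine ⟨σ, fun d e h => gapRight_injective (c.injective ?_), fun d => (hσ d).gap⟩
  rw [(hσ d).gap.1, (hσ e).gap.1, h]

/-- The gaps are those of the left half, extended by the outer one, and those of the right half,
extended by the middle one. -/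
def gapEquiv : Option (List Bool) ⊕ Option (List Bool) ≃ Option (List Bool) where
  toFun
    | .inl none => none
    | .inl (some w) => some (false :: w)
    | .inr none => some []
    | .inr (some w) => some (true :: w)
  invFun
    | none => .inl none
    | some [] => .inr none
    | some (false :: w) => .inl (some w)
    | some (true :: w) => .inr (some w)
  left_inv := by rintro ((_ | w) | (_ | w)) <;> rfl
  right_inv := by rintro (_ | _ | ⟨_ | _, w⟩) <;> rfl

/-- The gaps of `s` in the left half. -/
def leftGaps (s : Finset (Option (List Bool))) : Finset (Option (List Bool)) :=
  (s.map gapEquiv.symm.toEmbedding).toLeft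

/-- The gaps of `s` in the right half. -/
def rightGaps (s : Finset (Option (List Bool))) : Finset (Option (List Bool)) :=
  (s.map gapEquiv.symm.toEmbedding).toRight

lemma mem_leftGaps {s : Finset (Option (List Bool))} {d : Option (List Bool)} :
    d ∈ leftGaps s ↔ gapEquiv (.inl d) ∈ s := by
  simp [leftGaps, Finset.mem_toLeft]

lemma mem_rightGaps {s : Finset (Option (List Bool))} {d : Option (List Bool)} :
    d ∈ rightGaps s ↔ gapEquiv (.inr d) ∈ s := by
  simp [rightGaps, Finset.mem_toRight]

lemma card_leftGaps_add_card_rightGaps (s : Finset (Option (List Bool))) :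
    (leftGaps s).card + (rightGaps s).card = s.card := by
  rw [leftGaps, rightGaps, Finset.card_toLeft_add_card_toRight, Finset.card_map]

lemma gapStab_eq_map_join {s : Finset (Option (List Bool))} (hs : none ∈ s) (hs' : some [] ∈ s) :
    gapStab D s = ((gapStab D (leftGaps s)).prod (gapStab D (rightGaps s))).map joinHom := by
  ext k
  simp only [Subgroup.mem_map, Subgroup.mem_prod, Prod.exists, joinHom_apply]
  constructor
  · intro hk
    have hk' := (mem_gapStab.1 hk).2
    obtain ⟨g, hg, h, hh, rfl⟩ :=
      mem_splitGrp.1 (mem_splitGrp_of_fixes (gapStab_le_LMgrp hs hk) (hk' _ hs').1)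
    refine ⟨g, h, ⟨mem_gapStab.2 ⟨LMgrp_le_Shat hg, ?_⟩, mem_gapStab.2 ⟨LMgrp_le_Shat hh, ?_⟩⟩, rfl⟩
    · rintro (_ | w) hd
      · exact ⟨apply_const hg false, apply_const hg true⟩
      · simpa [gapRight_cons, gapLeft_cons] using hk' (some (false :: w)) (mem_leftGaps.1 hd)
    · rintro (_ | w) hd
      · exact ⟨apply_const hh false, apply_const hh true⟩
      · simpa [gapRight_cons, gapLeft_cons] using hk' (some (true :: w)) (mem_rightGaps.1 hd)
  · rintro ⟨g, h, ⟨hg, hh⟩, rfl⟩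
    have hgG := gapStab_le_LMgrp (mem_leftGaps.2 hs) hg
    have hhG := gapStab_le_LMgrp (mem_rightGaps.2 hs') hh
    have hG := join_mem hgG hhG
    refine mem_gapStab.2 ⟨LMgrp_le_Shat hG, ?_⟩
    rintro (_ | _ | ⟨_ | _, w⟩) hd
    · exact ⟨apply_const hG false, apply_const hG true⟩
    · simp [gapRight_nil, gapLeft_nil, apply_const hgG, apply_const hhG]
    · simpa [gapRight_cons, gapLeft_cons] using (mem_gapStab.1 hg).2 (some w) (mem_leftGaps.2 hd)
    · simpa [gapRight_cons, gapLeft_cons] using (mem_gapStab.1 hh).2 (some w) (mem_rightGaps.2 hd)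

/-- Concatenation of tuples, as an isomorphism of groups. -/
def appendMulEquiv (G : Type*) [Group G] (m n : ℕ) :
    (Fin m → G) × (Fin n → G) ≃* (Fin (m + n) → G) where
  __ := Fin.appendEquiv m n
  map_mul' a b := by
    funext i
    refine Fin.addCases (fun j => ?_) (fun j => ?_) i <;> simp [Fin.appendEquiv]

lemma nonempty_gapStab_equiv_of_conj {c : Cantor ≃ₜ Cantor} (hc : c ∈ Shat D)
    {s : Finset (Option (List Bool))} {d e : Option (List Bool)} (hd : d ∈ s)
    (hde : c (gapRight d) = gapRight e) {G : Type*} [Group G]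
    (h : ∀ t : Finset (Option (List Bool)), t.card = s.card → e ∈ t →
      (∀ i ∈ s, c (gapRight i) = gapRight i → i ∈ t) → Nonempty (gapStab D t ≃* G)) :
    Nonempty (gapStab D s ≃* G) := by
  obtain ⟨σ, hinj, hσ⟩ := exists_gap_map hc
  have hmem {i j : Option (List Bool)} (hi : i ∈ s) (hij : c (gapRight i) = gapRight j) :
      j ∈ s.image σ :=
    Finset.mem_image.2 ⟨i, hi, gapRight_injective ((hσ i).1.symm.trans hij)⟩
  obtain ⟨φ⟩ := h (s.image σ) (Finset.card_image_of_injective _ hinj) (hmem hd hde)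
    fun i hi hci => hmem hi hci
  exact ⟨(((MulAut.conj c).subgroupMap (gapStab D s)).trans
    (MulEquiv.subgroupCongr (map_conj_gapStab hc hσ s))).trans φ⟩

lemma nonempty_gapStab_equiv (s : Finset (Option (List Bool))) (hs : s.Nonempty) (n : ℕ)
    (hn : s.card = n) : Nonempty (gapStab D s ≃* (Fin n → LMgrp D)) := by
  induction n using Nat.strong_induction_on generalizing s with
  | _ n ih =>
    obtain ⟨d, hd⟩ := hs
    refine nonempty_gapStab_equiv_of_conj (recenter_mem d) hd (e := none) (recenter_gap d).1
      fun t ht hnone _ => ?_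
    rw [hn] at ht
    by_cases hsome : ∃ u, some u ∈ t
    · obtain ⟨u, hu⟩ := hsome
      refine nonempty_gapStab_equiv_of_conj (LMgrp_le_Shat (center_mem u)) hu (center_gap u).1
        fun r hr hnil hfix => ?_
      replace hnone := hfix none hnone (apply_const (center_mem u) false)
      have hl : (leftGaps r).Nonempty := ⟨none, mem_leftGaps.2 hnone⟩
      have hr' : (rightGaps r).Nonempty := ⟨none, mem_rightGaps.2 hnil⟩
      have hcard := (card_leftGaps_add_card_rightGaps r).trans (hr.trans ht)
      have hl0 := hl.card_pos
      have hr0 := hr'.card_pos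
      obtain ⟨φ⟩ := ih _ (by omega) (leftGaps r) hl rfl
      obtain ⟨ψ⟩ := ih _ (by omega) (rightGaps r) hr' rfl
      rw [← hcard, gapStab_eq_map_join hnone hnil]
      exact ⟨((Subgroup.equivMapOfInjective _ _ joinHom_injective).symm.trans
        (Subgroup.prodEquiv _ _)).trans ((φ.prodCongr ψ).trans (appendMulEquiv _ _ _))⟩
    · obtain rfl : t = {none} := by
        refine Finset.eq_singleton_iff_unique_mem.2 ⟨hnone, ?_⟩
        rintro (_ | u) hu
        · rfl
        · exact absurd ⟨u, hu⟩ hsome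
      obtain rfl : 1 = n := ht
      rw [gapStab_singleton_none]
      exact ⟨(MulEquiv.funUnique (Fin 1) _).symm⟩

end LodhaMoore

/-- if the `2(k+1)` points `u_i 1 0^∞`, `u_i 0 1^∞` are pairwise
distinct, then the subgroup of `Ŝ` fixing all of them is isomorphic to the direct
product of `k + 1` copies of `_yG_y`. -/
theorem statement11 (D : LMData) (k : ℕ) (u : Fin (k + 1) → List Bool)
    (hdist : Function.Injective (fun q : Fin (k + 1) × Bool =>
      if q.2 then cat (u q.1 ++ [true]) (fun _ => false)
      else cat (u q.1 ++ [false]) (fun _ => true))) :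
    Nonempty
      (↥(Shat D ⊓ fixingSubgroup'
          {ξ : Cantor | ∃ i : Fin (k + 1),
            ξ = cat (u i ++ [true]) (fun _ => false) ∨
            ξ = cat (u i ++ [false]) (fun _ => true)})
        ≃* (Fin (k + 1) → ↥(LMgrp D))) := by
  have hu : Function.Injective fun i => some (u i) := fun i j h => by
    have hij : u i = u j := Option.some_injective _ h
    have h' := @hdist (i, true) (j, true) (by simp [hij])
    exact congrArg Prod.fst h'
  obtain ⟨φ⟩ := LodhaMoore.nonempty_gapStab_equiv (D := D)
    (Finset.univ.image fun i => some (u i)) (Finset.univ_nonempty.image _) (k + 1)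
    (by rw [Finset.card_image_of_injective _ hu, Finset.card_univ, Fintype.card_fin])
  refine ⟨(MulEquiv.subgroupCongr ?_).trans φ⟩
  simp [LodhaMoore.gapStab, LodhaMoore.gapRight, LodhaMoore.gapLeft]
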